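/- arXiv:1607.01739 — 3 statements merged into one kernel-verified Lean document; each statement's English description precedes it below -/
import Mathlib

section
/- Let k = C(t,x,y) be the field of rational functions in three variables over the complex numbers. The biquaternion algebra A = (t,x) ⊗ (t+1,y) over k is a division algebra. -/
open scoped Quaternion TensorProduct

/-- The field `k = ℂ(t,x,y)` of rational functions in three variables over `ℂ`. -/
noncomputable abbrev RatFuncField3 : Type := FractionRing (MvPolynomial (Fin 3) ℂ)

/-- The element `t` of `ℂ(t,x,y)`. -/
noncomputable def rf_t : RatFuncField3 :=
  algebraMap (MvPolynomial (Fin 3) ℂ) RatFuncField3 (MvPolynomial.X 0)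

/-- The element `x` of `ℂ(t,x,y)`. -/
noncomputable def rf_x : RatFuncField3 :=
  algebraMap (MvPolynomial (Fin 3) ℂ) RatFuncField3 (MvPolynomial.X 1)

/-- The element `y` of `ℂ(t,x,y)`. -/
noncomputable def rf_y : RatFuncField3 :=
  algebraMap (MvPolynomial (Fin 3) ℂ) RatFuncField3 (MvPolynomial.X 2)

namespace QuaternionAlgebra.Basis

variable {R A : Type*} [CommRing R] [Ring A] [Algebra R A] {a b c d : R}

theorem commute_lift (q : Basis A a 0 b) (r : Basis A c 0 d)
    (hii : Commute q.i r.i) (hij : Commute q.i r.j) (hji : Commute q.j r.i)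
    (hjj : Commute q.j r.j) (x : ℍ[R,a,b]) (y : ℍ[R,c,d]) : Commute (q.lift x) (r.lift y) := by
  have hik : Commute q.i r.k := r.i_mul_j ▸ hii.mul_right hij
  have hjk : Commute q.j r.k := r.i_mul_j ▸ hji.mul_right hjj
  have hk {s : A} (hi : Commute q.i s) (hj : Commute q.j s) : Commute q.k s :=
    q.i_mul_j ▸ hi.mul_left hj
  have hs {s : A} (hi : Commute s r.i) (hj : Commute s r.j) (hk : Commute s r.k) :
      Commute s (r.lift y) :=
    (((Algebra.commute_algebraMap_right _ s).add_right (hi.smul_right _)).add_right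
      (hj.smul_right _)).add_right (hk.smul_right _)
  exact (((Algebra.commute_algebraMap_left _ _).add_left ((hs hii hij hik).smul_left _)).add_left
    ((hs hji hjj hjk).smul_left _)).add_left
      ((hs (hk hii hji) (hk hij hjj) (hk hik hjk)).smul_left _)

/-- The quaternion basis of `End K (K ⊗ P)` obtained from one of `End R P` by base change. -/
@[simps]
noncomputable def endBaseChange {P : Type*} (K : Type*) [CommRing K] [Algebra R K]
    [AddCommGroup P] [Module R P] (q : Basis (Module.End R P) a 0 b) :
    Basis (Module.End K (K ⊗[R] P)) (algebraMap R K a) 0 (algebraMap R K b) where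
  i := Module.End.baseChangeHom R K P q.i
  j := Module.End.baseChangeHom R K P q.j
  k := Module.End.baseChangeHom R K P q.k
  i_mul_i := by rw [← map_mul, q.i_mul_i]; simp
  j_mul_j := by rw [← map_mul, q.j_mul_j]; simp
  i_mul_j := by rw [← map_mul, q.i_mul_j]
  j_mul_i := by
    rw [← map_mul, q.j_mul_i, zero_smul, zero_smul, zero_sub]
    exact (map_neg _ _).trans (zero_sub _).symm

end QuaternionAlgebra.Basis

theorem isUnit_of_forall_apply_eq_zero {K A V : Type*} [Field K] [Ring A] [Algebra K A]
    [FiniteDimensional K A] [AddCommGroup V] [Nontrivial V] [Module K V]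
    (Φ : A →ₐ[K] Module.End K V) (h : ∀ z v, Φ z v = 0 → z = 0 ∨ v = 0) {z : A} (hz : z ≠ 0) :
    IsUnit z := by
  obtain ⟨v, hv⟩ := exists_ne (0 : V)
  have : NoZeroDivisors A := ⟨fun {x y} hxy ↦ by
    have := h x (Φ y v) (by rw [← Module.End.mul_apply, ← map_mul, hxy]; simp)
    exact this.imp_right fun hy ↦ (h y v hy).resolve_right hv⟩
  have : Nontrivial A := ⟨z, 0, hz⟩
  have : IsDomain A := NoZeroDivisors.to_isDomain A
  exact FiniteDimensional.isUnit K hz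

theorem isUnit_of_action {R K P : Type*} [CommRing R] [IsDomain R] [Field K] [Algebra R K]
    [IsFractionRing R K] [AddCommGroup P] [Module R P] [Module.IsTorsionFree R P] [Nontrivial P]
    {a b c d : R} (q : QuaternionAlgebra.Basis (Module.End R P) a 0 b)
    (r : QuaternionAlgebra.Basis (Module.End R P) c 0 d)
    (hii : Commute q.i r.i) (hij : Commute q.i r.j) (hji : Commute q.j r.i) (hjj : Commute q.j r.j)
    (hinj : ∀ (s : Fin 4 × Fin 4 → R) (f : P),
      ∑ p, s p • ((![1, q.i, q.j, q.k] p.1 * ![1, r.i, r.j, r.k] p.2 : Module.End R P) f) = 0 →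
        s = 0 ∨ f = 0)
    (z : ℍ[K, algebraMap R K a, algebraMap R K b] ⊗[K] ℍ[K, algebraMap R K c, algebraMap R K d])
    (hz : z ≠ 0) : IsUnit z := by
  let β := Module.End.baseChangeHom R K P
  let ι : P →ₗ[R] K ⊗[R] P := TensorProduct.mk R K P 1
  have hloc : IsLocalizedModule (nonZeroDivisors R) ι :=
    (isLocalizedModule_iff_isBaseChange (nonZeroDivisors R) K ι).2
      (TensorProduct.isBaseChange R P K)
  have hι : Function.Injective ι := by
    intro x y hxy
    obtain ⟨u, hu⟩ := (IsLocalizedModule.eq_iff_exists (nonZeroDivisors R) ι).1 hxy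
    exact smul_right_injective P (nonZeroDivisors.coe_ne_zero u) hu
  have : Nontrivial (K ⊗[R] P) := hι.nontrivial
  let Φ := Algebra.TensorProduct.lift (q.endBaseChange K).liftHom (r.endBaseChange K).liftHom
    fun x y ↦ QuaternionAlgebra.Basis.commute_lift (q.endBaseChange K) (r.endBaseChange K)
      (hii.map β) (hij.map β) (hji.map β) (hjj.map β) x y
  refine isUnit_of_forall_apply_eq_zero Φ (fun z v hzv ↦ ?_) hz
  let e := (QuaternionAlgebra.basisOneIJK (algebraMap R K a) 0 (algebraMap R K b)).tensorProduct
    (QuaternionAlgebra.basisOneIJK (algebraMap R K c) 0 (algebraMap R K d))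
  have he (p : Fin 4 × Fin 4) :
      Φ (e p) = β (![1, q.i, q.j, q.k] p.1 * ![1, r.i, r.j, r.k] p.2) := by
    have hb {a b : R} (q : QuaternionAlgebra.Basis (Module.End R P) a 0 b) (l : Fin 4) :
        (q.endBaseChange K).liftHom
          (QuaternionAlgebra.basisOneIJK (algebraMap R K a) 0 (algebraMap R K b) l) =
          β (![1, q.i, q.j, q.k] l) := by
      fin_cases l <;>
        simp [β, QuaternionAlgebra.basisOneIJK, QuaternionAlgebra.Basis.lift]
    rw [map_mul, ← hb, ← hb, Module.Basis.tensorProduct_apply]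
    rfl
  obtain ⟨N, hN⟩ := IsLocalization.exist_integer_multiples_of_finite (nonZeroDivisors R) (e.repr z)
  choose s hs using hN
  obtain ⟨⟨f, M⟩, hf⟩ := IsLocalizedModule.surj (nonZeroDivisors R) ι v
  replace hf : algebraMap R K M • v = ι f := (algebraMap_smul K (M : R) v).trans hf
  have hz' : algebraMap R K N • z = ∑ p, algebraMap R K (s p) • e p := by
    conv_lhs => rw [← e.sum_repr z, Finset.smul_sum]
    refine Finset.sum_congr rfl fun p _ ↦ ?_
    rw [hs, smul_smul, Algebra.smul_def (N : R)]
  have h0 : ι (∑ p, s p • ((![1, q.i, q.j, q.k] p.1 * ![1, r.i, r.j, r.k] p.2 :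
      Module.End R P) f)) = 0 := by
    calc _ = Φ (algebraMap R K N • z) (ι f) := by
          rw [hz', map_sum, map_sum, LinearMap.sum_apply]
          refine Finset.sum_congr rfl fun p _ ↦ ?_
          rw [map_smul, map_smul, he, LinearMap.smul_apply, algebraMap_smul]
          rfl
      _ = 0 := by rw [← hf, map_smul, map_smul Φ, LinearMap.smul_apply, hzv, smul_zero, smul_zero]
  refine (hinj s f ((map_eq_zero_iff ι hι).1 h0)).imp (fun h ↦ ?_) (fun h ↦ ?_)
  · exact (smul_eq_zero.1 (hz'.trans (by simp [h]))).resolve_left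
      (IsFractionRing.to_map_ne_zero_of_mem_nonZeroDivisors N.2)
  · exact (smul_eq_zero.1 (hf.trans (by simp [h]))).resolve_left
      (IsFractionRing.to_map_ne_zero_of_mem_nonZeroDivisors M.2)

namespace MvPolynomial

variable {σ R : Type*} [CommSemiring R] (m : MonomialOrder σ)

theorem eq_zero_of_sum_eq_zero_of_degree_injOn {ι : Type*} [Fintype ι] (p : ι → MvPolynomial σ R)
    (hp : ∀ i j, p i ≠ 0 → p j ≠ 0 → m.degree (p i) = m.degree (p j) → i = j)
    (h : ∑ i, p i = 0) (i : ι) : p i = 0 := by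
  classical
  by_contra hi
  obtain ⟨j, hj, hmax⟩ := Finset.exists_max_image (Finset.univ.filter (p · ≠ 0))
    (fun i ↦ m.toSyn (m.degree (p i))) ⟨i, by simpa using hi⟩
  simp only [Finset.mem_filter, Finset.mem_univ, true_and] at hj hmax
  have hc := congrArg (coeff (m.degree (p j))) h
  rw [coeff_sum, Finset.sum_eq_single j, coeff_zero, m.coeff_degree_eq_zero_iff] at hc
  · exact hj hc
  · intro l _ hl
    by_cases h0 : p l = 0
    · simp [h0]
    · refine m.coeff_eq_zero_of_lt (lt_of_le_of_ne (hmax l h0) fun he ↦ hl ?_)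
      exact hp l j h0 hj (m.toSyn.injective he)
  · simp

theorem degree_map_of_injective {S : Type*} [CommSemiring S] (f : R →+* S)
    (hf : Function.Injective f) (p : MvPolynomial σ R) :
    m.degree (map f p) = m.degree p := by
  simp only [MonomialOrder.degree, support_map_of_injective _ hf]

theorem dvd_degree_expand (n : ℕ) (p : MvPolynomial σ R) (i : σ) :
    n ∣ m.degree (expand n p) i := by
  by_cases h : expand n p = 0
  · simp [h]
  · by_contra hd
    exact h (m.coeff_degree_eq_zero_iff.1 (coeff_expand_of_not_dvd _ hd))

/-- Terms whose exponents are pairwise incongruent modulo `n`, up to a common shift, cannot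
cancel. -/
theorem eq_zero_of_sum_expand_mul_monomial_mul_eq_zero [NoZeroDivisors R] [Nontrivial R]
    {ι : Type*} [Fintype ι] {n : ℕ} (hn : 0 < n) (a : ι → MvPolynomial σ R) (e : ι → σ →₀ ℕ)
    (he : ∀ i j, (∀ l, e i l ≡ e j l [MOD n]) → i = j) (f : ι → MvPolynomial σ R)
    (hf : ∀ i, f i ≠ 0) (hdeg : ∀ i j, m.degree (f i) = m.degree (f j))
    (h : ∑ i, expand n (a i) * monomial (e i) 1 * f i = 0) (i : ι) : a i = 0 := by
  classical
  have hm (i) : (monomial (e i) 1 : MvPolynomial σ R) ≠ 0 := by simp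
  have key := eq_zero_of_sum_eq_zero_of_degree_injOn m _ (fun i j hi hj hij ↦ he i j fun l ↦ ?_) h i
  · simpa [hf i, hm i, expand_eq_zero hn] using key
  · have hi' := left_ne_zero_of_mul hi
    have hj' := left_ne_zero_of_mul hj
    rw [m.degree_mul hi' (hf i), m.degree_mul hj' (hf j), hdeg i j, add_left_inj,
      m.degree_mul (left_ne_zero_of_mul hi') (hm i), m.degree_mul (left_ne_zero_of_mul hj') (hm j),
      m.degree_monomial, m.degree_monomial, if_neg one_ne_zero, if_neg one_ne_zero] at hij
    have hl := DFunLike.congr_fun hij l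
    obtain ⟨x, hx⟩ := dvd_degree_expand m n (a i) l
    obtain ⟨y, hy⟩ := dvd_degree_expand m n (a j) l
    rw [Finsupp.add_apply, Finsupp.add_apply, hx, hy] at hl
    simpa [Nat.ModEq] using congrArg (· % n) hl

end MvPolynomial

/-- Over the fixed ring of two involutions, `1, u, w, u * w` are linearly independent when the
involutions change the sign of `u` and of `w` respectively. -/
theorem eq_zero_of_add_mul_eq_zero {P : Type*} [CommRing P] [IsDomain P] (h2 : (2 : P) ≠ 0)
    (σ τ : P →+* P) {u w : P} (hu : u ≠ 0) (hw : w ≠ 0) (hσu : σ u = -u) (hσw : σ w = w)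
    (hτu : τ u = u) (hτw : τ w = -w) (c : Fin 4 → P) (hσ : ∀ i, σ (c i) = c i)
    (hτ : ∀ i, τ (c i) = c i) (h : c 0 + u * c 1 + w * c 2 + u * w * c 3 = 0) : c = 0 := by
  have h₁ := congrArg σ h
  have h₂ := congrArg τ h
  have h₃ := congrArg σ h₂
  simp only [map_add, map_mul, map_neg, map_zero, hσ, hτ, hσu, hσw, hτu, hτw] at h₁ h₂ h₃
  have h4 : (2 * 2 : P) ≠ 0 := mul_ne_zero h2 h2
  ext i
  fin_cases i
  · exact (mul_eq_zero.1 (show 2 * 2 * c 0 = 0 by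
      linear_combination h + h₁ + h₂ + h₃)).resolve_left h4
  · exact (mul_eq_zero.1 (show 2 * 2 * u * c 1 = 0 by
      linear_combination h - h₁ + h₂ - h₃)).resolve_left (mul_ne_zero h4 hu)
  · exact (mul_eq_zero.1 (show 2 * 2 * w * c 2 = 0 by
      linear_combination h + h₁ - h₂ - h₃)).resolve_left (mul_ne_zero h4 hw)
  · exact (mul_eq_zero.1 (show 2 * 2 * (u * w) * c 3 = 0 by
      linear_combination h - h₁ - h₂ + h₃)).resolve_left (mul_ne_zero h4 (mul_ne_zero hu hw))

/-- The quaternion basis of `End R P` given by multiplication by `u` and the twisted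
multiplication `f ↦ ξ * s f`, where `s` is an involution with `s u = -u` and `s ξ = ξ`. -/
@[simps]
noncomputable def QuaternionAlgebra.Basis.twisted {R P : Type*} [CommRing R] [CommRing P]
    [Algebra R P] {a b : R} (s : P →ₐ[R] P) (u ξ : P) (hs : ∀ f, s (s f) = f) (hu : s u = -u)
    (hξ : s ξ = ξ) (ha : u * u = algebraMap R P a) (hb : ξ * ξ = algebraMap R P b) :
    QuaternionAlgebra.Basis (Module.End R P) a 0 b where
  i := LinearMap.mulLeft R u
  j := LinearMap.mulLeft R ξ * s.toLinearMap
  k := LinearMap.mulLeft R u * (LinearMap.mulLeft R ξ * s.toLinearMap)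
  i_mul_i := by ext f; simp [← mul_assoc, ha, Algebra.smul_def]
  j_mul_j := by ext f; simp [← mul_assoc, hb, hs, hξ, Algebra.smul_def]
  i_mul_j := rfl
  j_mul_i := by ext f; simp [hu]; ring

open MvPolynomial in
/-- If `R` embeds into the polynomials over `T` fixed by two commuting involutions, with `a = u²`
and `c = w²` where the sign of `u` is changed by the first involution only and that of `w` by the
second only, and with `b`, `d` the variables, then `(a, b) ⊗ (c, d)` is a division algebra: it acts
on the polynomials in square roots of the variables so that leading terms never cancel. -/
theorem biquaternion_isUnit {R K T : Type*} [CommRing R] [IsDomain R] [Field K] [Algebra R K]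
    [IsFractionRing R K] [CommRing T] [IsDomain T] (h2 : (2 : T) ≠ 0) (σ τ : T →+* T) {u w : T}
    (hu : u ≠ 0) (hw : w ≠ 0) (hσσ : ∀ x, σ (σ x) = x) (hττ : ∀ x, τ (τ x) = x)
    (hστ : ∀ x, σ (τ x) = τ (σ x)) (hσu : σ u = -u) (hσw : σ w = w) (hτu : τ u = u)
    (hτw : τ w = -w) (φ : R →+* MvPolynomial (Fin 2) T) (hφ : Function.Injective φ)
    (hφσ : ∀ r, map σ (φ r) = φ r) (hφτ : ∀ r, map τ (φ r) = φ r) {a b c d : R}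
    (ha : φ a = C (u ^ 2)) (hb : φ b = X 0) (hc : φ c = C (w ^ 2)) (hd : φ d = X 1)
    (z : ℍ[K, algebraMap R K a, algebraMap R K b] ⊗[K] ℍ[K, algebraMap R K c, algebraMap R K d])
    (hz : z ≠ 0) : IsUnit z := by
  let ψ : R →+* MvPolynomial (Fin 2) T :=
    (expand 2 : MvPolynomial (Fin 2) T →ₐ[T] MvPolynomial (Fin 2) T).toRingHom.comp φ
  let _ : Algebra R (MvPolynomial (Fin 2) T) := ψ.toAlgebra
  have hψ (r : R) : algebraMap R (MvPolynomial (Fin 2) T) r = expand 2 (φ r) := rfl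
  have hψinj : Function.Injective (algebraMap R (MvPolynomial (Fin 2) T)) :=
    (expand_injective two_pos).comp hφ
  have : FaithfulSMul R (MvPolynomial (Fin 2) T) :=
    (faithfulSMul_iff_algebraMap_injective R (MvPolynomial (Fin 2) T)).2 hψinj
  have : Module.IsTorsionFree R (MvPolynomial (Fin 2) T) := inferInstance
  let S : MvPolynomial (Fin 2) T →ₐ[R] MvPolynomial (Fin 2) T := ⟨map σ, fun r ↦ by
    change map σ (expand 2 (φ r)) = expand 2 (φ r); rw [map_expand, hφσ]⟩
  let S' : MvPolynomial (Fin 2) T →ₐ[R] MvPolynomial (Fin 2) T := ⟨map τ, fun r ↦ by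
    change map τ (expand 2 (φ r)) = expand 2 (φ r); rw [map_expand, hφτ]⟩
  have hS (f : MvPolynomial (Fin 2) T) : S f = map σ f := rfl
  have hS' (f : MvPolynomial (Fin 2) T) : S' f = map τ f := rfl
  let q : QuaternionAlgebra.Basis (Module.End R (MvPolynomial (Fin 2) T)) a 0 b :=
    .twisted S (C u) (X 0)
    (fun f ↦ by rw [hS, hS, map_map, RingHom.ext (f := σ.comp σ) (g := .id T) hσσ, map_id])
    (by simp [hS, hσu]) (by simp [hS]) (by simp [hψ, ha, pow_two]) (by simp [hψ, hb, pow_two])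
  let r : QuaternionAlgebra.Basis (Module.End R (MvPolynomial (Fin 2) T)) c 0 d :=
    .twisted S' (C w) (X 1)
    (fun f ↦ by rw [hS', hS', map_map, RingHom.ext (f := τ.comp τ) (g := .id T) hττ, map_id])
    (by simp [hS', hτw]) (by simp [hS']) (by simp [hψ, hc, pow_two]) (by simp [hψ, hd, pow_two])
  have hSS' (f : MvPolynomial (Fin 2) T) : S (S' f) = S' (S f) := by
    rw [hS, hS', hS, hS', map_map, map_map, RingHom.ext (f := σ.comp τ) (g := τ.comp σ) hστ]
  refine isUnit_of_action q r ?_ ?_ ?_ ?_ (fun s f hsum ↦ ?_) z hz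
  · ext1 f
    simp [q, r]
    ring
  · ext1 f
    simp [q, r, hS', hτu]
    ring
  · ext1 f
    simp [q, r, hS, hσw]
    ring
  · ext1 f
    simp [q, r, hSS']
    simp [hS, hS']
    ring
  · by_cases hf : f = 0
    · exact .inr hf
    have hσinj : Function.Injective σ := (show Function.Involutive σ from hσσ).injective
    have hτinj : Function.Injective τ := (show Function.Involutive τ from hττ).injective
    let A (g : Fin 2 × Fin 2) : MvPolynomial (Fin 2) T :=
      φ (s (![0, 2] g.1, ![0, 2] g.2)) + C u * φ (s (![1, 3] g.1, ![0, 2] g.2)) +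
        C w * φ (s (![0, 2] g.1, ![1, 3] g.2)) + C u * C w * φ (s (![1, 3] g.1, ![1, 3] g.2))
    have hA : ∀ g, A g = 0 := by
      refine eq_zero_of_sum_expand_mul_monomial_mul_eq_zero MonomialOrder.lex two_pos A
        (fun g ↦ Finsupp.single 0 (g.1 : ℕ) + Finsupp.single 1 (g.2 : ℕ)) ?_
        (fun g ↦ ![id, map σ] g.1 (![id, map τ] g.2 f)) ?_ ?_ ?_
      · intro i j h
        have h0 := h 0
        have h1 := h 1
        revert h0 h1
        fin_cases i <;> fin_cases j <;> simp [Nat.ModEq]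
      · rintro ⟨i, j⟩
        fin_cases i <;> fin_cases j <;>
          simp [hf, map_eq_zero_iff _ (map_injective σ hσinj),
            map_eq_zero_iff _ (map_injective τ hτinj)]
      · suffices ∀ g : Fin 2 × Fin 2, MonomialOrder.lex.degree
            (![id, map σ] g.1 (![id, map τ] g.2 f)) = MonomialOrder.lex.degree f from
          fun i j ↦ (this i).trans (this j).symm
        rintro ⟨i, j⟩
        fin_cases i <;> fin_cases j <;> simp [degree_map_of_injective, hσinj, hτinj]
      · have hX : X 0 = monomial (Finsupp.single (0 : Fin 2) 1) (1 : T) := rfl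
        rw [← hsum]
        simp [Fintype.sum_prod_type, Fin.sum_univ_succ, A, q, r, hS, hS', Algebra.smul_def, hψ, hσw,
          ← hX, monomial_add_single]
        ring
    have hs (g : Fin 2 × Fin 2) := eq_zero_of_add_mul_eq_zero (P := MvPolynomial (Fin 2) T)
      (by rwa [← map_ofNat C 2, map_ne_zero_iff C (C_injective _ _)]) (map σ) (map τ)
      (by simpa using hu) (by simpa using hw) (by simp [hσu]) (by simp [hσw]) (by simp [hτu])
      (by simp [hτw])
      ![φ (s (![0, 2] g.1, ![0, 2] g.2)), φ (s (![1, 3] g.1, ![0, 2] g.2)),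
        φ (s (![0, 2] g.1, ![1, 3] g.2)), φ (s (![1, 3] g.1, ![1, 3] g.2))]
      (fun i ↦ by fin_cases i <;> exact hφσ _) (fun i ↦ by fin_cases i <;> exact hφτ _) (hA g)
    left
    ext ⟨i, j⟩
    refine (map_eq_zero_iff φ hφ).1 ?_
    fin_cases i <;> fin_cases j
    · exact congrFun (hs (0, 0)) 0
    · exact congrFun (hs (0, 0)) 2
    · exact congrFun (hs (0, 1)) 0
    · exact congrFun (hs (0, 1)) 2
    · exact congrFun (hs (0, 0)) 1
    · exact congrFun (hs (0, 0)) 3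
    · exact congrFun (hs (0, 1)) 1
    · exact congrFun (hs (0, 1)) 3
    · exact congrFun (hs (1, 0)) 0
    · exact congrFun (hs (1, 0)) 2
    · exact congrFun (hs (1, 1)) 0
    · exact congrFun (hs (1, 1)) 2
    · exact congrFun (hs (1, 0)) 1
    · exact congrFun (hs (1, 0)) 3
    · exact congrFun (hs (1, 1)) 1
    · exact congrFun (hs (1, 1)) 3

namespace LaurentPolynomial

variable {k : Type*} [Field k]

theorem T_one_mul_T_neg_one {R : Type*} [Semiring R] : (T 1 : R[T;T⁻¹]) * T (-1) = 1 := by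
  rw [← T_add, Int.add_right_neg, T_zero]

variable (k) in
/-- The involution of `k[T;T⁻¹]` sending `T` to `-T`. -/
noncomputable def negVar : k[T;T⁻¹] →ₐ[k] k[T;T⁻¹] :=
  AddMonoidAlgebra.lift k k[T;T⁻¹] ℤ
    { toFun n := C ((-1) ^ n.toAdd) * T n.toAdd
      map_one' := by simp
      map_mul' m n := by
        rw [toAdd_mul, zpow_add₀ (neg_ne_zero.2 one_ne_zero), T_add, map_mul]
        ring }

theorem negVar_T (n : ℤ) : negVar k (T n) = C ((-1) ^ n) * T n :=
  (AddMonoidAlgebra.lift_single ..).trans (one_smul _ _)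

theorem negVar_C (a : k) : negVar k (C a) = C a := (negVar k).commutes a

theorem algHom_ext_T {A : Type*} [Semiring A] [Algebra k A] {f g : k[T;T⁻¹] →ₐ[k] A}
    (h : ∀ n, f (T n) = g (T n)) : f = g :=
  AlgHom.coe_ringHom_injective <|
    AddMonoidAlgebra.ringHom_ext (fun r ↦ (f.commutes r).trans (g.commutes r).symm) h

theorem neg_one_zpow_mul_self (n : ℤ) : ((-1 : k) ^ n) * (-1) ^ n = 1 := by
  rw [← mul_zpow, neg_one_mul, neg_neg, one_zpow]

theorem negVar_negVar (p : k[T;T⁻¹]) : negVar k (negVar k p) = p := by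
  suffices (negVar k).comp (negVar k) = .id k _ from DFunLike.congr_fun this p
  refine algHom_ext_T fun n ↦ ?_
  rw [AlgHom.comp_apply, negVar_T, map_mul, negVar_C, negVar_T, ← mul_assoc, ← map_mul,
    neg_one_zpow_mul_self, map_one, one_mul, AlgHom.id_apply]

theorem invert_negVar (p : k[T;T⁻¹]) : invert (negVar k p) = negVar k (invert p) := by
  suffices (invert (R := k)).toAlgHom.comp (negVar k) = (negVar k).comp invert.toAlgHom from
    DFunLike.congr_fun this p
  refine algHom_ext_T fun n ↦ ?_
  change invert (negVar k (T n)) = negVar k (invert (T n))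
  rw [negVar_T, map_mul, invert_C, invert_T, negVar_T, zpow_neg,
    ← eq_inv_of_mul_eq_one_left (neg_one_zpow_mul_self n)]

variable (k) in
/-- One half of `T - T⁻¹`. -/
noncomputable def halfSub : k[T;T⁻¹] := C (1 / 2) * (T 1 - T (-1))

variable (k) in
/-- One half of `T + T⁻¹`. -/
noncomputable def halfAdd : k[T;T⁻¹] := C (1 / 2) * (T 1 + T (-1))

theorem halfAdd_sq (h2 : (2 : k) ≠ 0) : halfAdd k ^ 2 = halfSub k ^ 2 + 1 := by
  have h : (C (1 / 2 : k)) * 2 = 1 := by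
    rw [← map_ofNat C 2, ← map_mul, one_div_mul_cancel h2, map_one]
  rw [halfAdd, halfSub]
  linear_combination (4 * C (1 / 2 : k) ^ 2) * T_one_mul_T_neg_one (R := k) +
    (C (1 / 2 : k) * 2 + 1) * h

theorem invert_halfSub : invert (halfSub k) = -halfSub k := by
  rw [halfSub, map_mul, map_sub, invert_C, invert_T, invert_T, neg_neg]
  ring

theorem invert_halfAdd : invert (halfAdd k) = halfAdd k := by
  rw [halfAdd, map_mul, map_add, invert_C, invert_T, invert_T, neg_neg, add_comm]

theorem negVar_halfSub : negVar k (halfSub k) = -halfSub k := by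
  rw [halfSub, map_mul, map_sub, negVar_C, negVar_T, negVar_T]
  simp
  ring

theorem negVar_halfAdd : negVar k (halfAdd k) = -halfAdd k := by
  rw [halfAdd, map_mul, map_add, negVar_C, negVar_T, negVar_T]
  simp
  ring

theorem eval₂_halfSub (s : kˣ) :
    eval₂ (RingHom.id k) s (halfSub k) = 1 / 2 * (s - (s⁻¹ : kˣ)) := by
  simp [halfSub]

theorem exists_eval₂_halfSub_sq [IsAlgClosed k] (h2 : (2 : k) ≠ 0) (x : k) :
    ∃ s : kˣ, eval₂ (RingHom.id k) s (halfSub k) ^ 2 = x := by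
  obtain ⟨v, hv⟩ := IsAlgClosed.exists_pow_nat_eq x two_pos
  obtain ⟨r, hr⟩ := IsAlgClosed.exists_pow_nat_eq (x + 1) two_pos
  have h : (v + r) * (r - v) = 1 := by linear_combination hr - hv
  refine ⟨⟨v + r, r - v, h, by rw [mul_comm, h]⟩, ?_⟩
  rw [eval₂_halfSub, ← hv]
  simp only [Units.inv_mk]
  field_simp
  ring

theorem halfSub_ne_zero [IsAlgClosed k] (h2 : (2 : k) ≠ 0) : halfSub k ≠ 0 := by
  intro h
  obtain ⟨s, hs⟩ := exists_eval₂_halfSub_sq h2 1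
  simp [h] at hs

theorem halfAdd_ne_zero [IsAlgClosed k] (h2 : (2 : k) ≠ 0) : halfAdd k ≠ 0 := by
  intro h
  obtain ⟨s, hs⟩ := exists_eval₂_halfSub_sq h2 0
  have := congrArg (eval₂ (RingHom.id k) s) (halfAdd_sq h2)
  simp [h, hs] at this

end LaurentPolynomial

open LaurentPolynomial (halfAdd halfAdd_ne_zero halfAdd_sq halfSub halfSub_ne_zero invert_halfAdd
  invert_halfSub invert_negVar negVar negVar_halfAdd negVar_halfSub negVar_negVar)

namespace MvPolynomial

variable (k : Type*) [Field k]

/-- The embedding of `k[t, x, y]` into `k[s, s⁻¹][x, y]` with `t = ((s - s⁻¹) / 2) ^ 2`. -/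
noncomputable def uniformize :
    MvPolynomial (Fin 3) k →ₐ[k] MvPolynomial (Fin 2) (LaurentPolynomial k) :=
  aeval ![C (halfSub k ^ 2), X 0, X 1]

variable {k}

theorem map_uniformize (σ : LaurentPolynomial k →ₐ[k] LaurentPolynomial k)
    (hσ : σ (halfSub k ^ 2) = halfSub k ^ 2) (p : MvPolynomial (Fin 3) k) :
    map (σ : LaurentPolynomial k →+* LaurentPolynomial k) (uniformize k p) = uniformize k p := by
  suffices (mapAlgHom σ).comp (uniformize k) = uniformize k from DFunLike.congr_fun this p
  ext1 i
  fin_cases i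
  · simpa [uniformize] using congrArg C hσ
  · simp [uniformize]
  · simp [uniformize]

theorem uniformize_injective [IsAlgClosed k] (h2 : (2 : k) ≠ 0) :
    Function.Injective (uniformize k) := by
  refine (injective_iff_map_eq_zero _).2 fun p hp ↦ funext fun x ↦ ?_
  obtain ⟨s, hs⟩ := LaurentPolynomial.exists_eval₂_halfSub_sq h2 (x 0)
  let E := eval₂Hom (LaurentPolynomial.eval₂ (RingHom.id k) s) ![x 1, x 2]
  suffices E.comp (uniformize k : MvPolynomial (Fin 3) k →+* _) = eval x by
    rw [← this, RingHom.comp_apply, RingHom.coe_coe, hp, map_zero, map_zero]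
  refine ringHom_ext (fun a ↦ ?_) fun i ↦ ?_
  · simp [E, uniformize, MvPolynomial.algebraMap_apply]
  · fin_cases i <;> simp [E, uniformize, hs]

/-- The biquaternion algebra `(t, x) ⊗ (t + 1, y)` over a field of fractions of `k[t, x, y]` is a
division algebra. -/
theorem isUnit_of_biquaternion [IsAlgClosed k] (h2 : (2 : k) ≠ 0)
    {K : Type*} [Field K] [Algebra (MvPolynomial (Fin 3) k) K]
    [IsFractionRing (MvPolynomial (Fin 3) k) K] {a b c d : K}
    (ha : a = algebraMap (MvPolynomial (Fin 3) k) K (X 0))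
    (hb : b = algebraMap (MvPolynomial (Fin 3) k) K (X 1))
    (hc : c = algebraMap (MvPolynomial (Fin 3) k) K (X 0 + 1))
    (hd : d = algebraMap (MvPolynomial (Fin 3) k) K (X 2))
    (z : ℍ[K, a, b] ⊗[K] ℍ[K, c, d]) (hz : z ≠ 0) : IsUnit z := by
  subst ha hb hc hd
  obtain ⟨σ, hσ⟩ : ∃ σ : LaurentPolynomial k →ₐ[k] LaurentPolynomial k,
      ∀ p, σ p = LaurentPolynomial.invert p := ⟨LaurentPolynomial.invert.toAlgHom, fun _ ↦ rfl⟩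
  obtain ⟨τ, hτ⟩ : ∃ τ : LaurentPolynomial k →ₐ[k] LaurentPolynomial k,
      ∀ p, τ p = negVar k (LaurentPolynomial.invert p) := ⟨(negVar k).comp σ, fun p ↦ by
    rw [AlgHom.comp_apply, hσ]⟩
  have hσσ (p) : σ (σ p) = p := by rw [hσ, hσ, LaurentPolynomial.involutive_invert]
  have hττ (p) : τ (τ p) = p := by
    rw [hτ, hτ, invert_negVar, negVar_negVar, LaurentPolynomial.involutive_invert]
  have hστ (p) : σ (τ p) = τ (σ p) := by rw [hσ, hτ, hτ, hσ, invert_negVar]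
  have hσu : σ (halfSub k) = -halfSub k := by rw [hσ, invert_halfSub]
  have hσw : σ (halfAdd k) = halfAdd k := by rw [hσ, invert_halfAdd]
  have hτu : τ (halfSub k) = halfSub k := by
    rw [hτ, invert_halfSub, map_neg, negVar_halfSub, neg_neg]
  have hτw : τ (halfAdd k) = -halfAdd k := by rw [hτ, invert_halfAdd, negVar_halfAdd]
  have h2' : (2 : LaurentPolynomial k) ≠ 0 := by
    rwa [← map_ofNat LaurentPolynomial.C 2, map_ne_zero]
  have h0 : uniformize k (X 0) = C (halfSub k ^ 2) := by simp [uniformize]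
  have h1 : uniformize k (X 1) = X 0 := by simp [uniformize]
  have h01 : uniformize k (X 0 + 1) = C (halfAdd k ^ 2) := by
    rw [map_add, map_one, h0, halfAdd_sq h2, map_add, map_one]
  have h2X : uniformize k (X 2) = X 1 := by simp [uniformize]
  have hφσ := map_uniformize σ (by rw [map_pow, hσu, neg_sq])
  have hφτ := map_uniformize τ (by rw [map_pow, hτu])
  exact biquaternion_isUnit h2' (σ : LaurentPolynomial k →+* LaurentPolynomial k)
    (τ : LaurentPolynomial k →+* LaurentPolynomial k) (halfSub_ne_zero h2) (halfAdd_ne_zero h2)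
    hσσ hττ hστ hσu hσw hτu hτw
    (uniformize k : MvPolynomial (Fin 3) k →+* MvPolynomial (Fin 2) (LaurentPolynomial k))
    (uniformize_injective h2) hφσ hφτ h0 h1 h01 h2X z hz

end MvPolynomial

/-- Over `k = ℂ(t,x,y)`, the biquaternion algebra
`A = (t,x) ⊗ (t+1,y)` is a division algebra (every nonzero element is a unit). -/
theorem stmt5 :
    ∀ z : ℍ[RatFuncField3, rf_t, rf_x] ⊗[RatFuncField3] ℍ[RatFuncField3, rf_t + 1, rf_y],
      z ≠ 0 → IsUnit z :=
  MvPolynomial.isUnit_of_biquaternion two_ne_zero rfl rfl (by rw [map_add, map_one, rf_t]) rfl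
end

section
/- Let k be a field of characteristic zero, K/k a separable field extension of degree 2, C a smooth conic over K whose Brauer class [C] ∈ Br(K) lies in the image of the restriction map Br(k) → Br(K), and let X = R_{K/k} C be the Weil restriction, with X(k) = ∅. Then the index I(X) of X equals 2, i.e. X acquires a rational point over some quadratic extension of k. -/
open scoped Quaternion TensorProduct

/-- A witness that the Brauer class `[C] = [(a,b)] ∈ Br(K)` of the conic
`C : a x² + b y² = z²` lies in the image of the restriction map `Br(k) → Br(K)`:
a finite-dimensional central simple `k`-algebra `D` with `D ⊗_k K` Brauer-equivalent
(matrix rings over them are isomorphic) to the quaternion algebra `(a,b)` over `K`. -/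
structure CentralSimpleLift (k K : Type) [Field k] [Field K] [Algebra k K] (a b : K) where
  D : Type
  [ringD : Ring D]
  [algD : Algebra k D]
  finite : FiniteDimensional k D
  central : Algebra.IsCentral k D
  simple : IsSimpleRing D
  n : ℕ
  m : ℕ
  npos : 0 < n
  mpos : 0 < m
  equiv : Nonempty ((Matrix (Fin n) (Fin n) (K ⊗[k] D)) ≃ₐ[K]
    (Matrix (Fin m) (Fin m) ℍ[K,a,b]))

/-- A point of the Weil restriction `X = R_{K/k} C` over a quadratic extension `k'` of `k`:
by the universal property, `X(k') = C(K ⊗_k k')`, so this is a nontrivial solution of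
`a x² + b y² = z²` in `K ⊗_k k'`. -/
structure QuadraticPointWitness (k K : Type) [Field k] [Field K] [Algebra k K] (a b : K) where
  k' : Type
  [fieldk' : Field k']
  [algk' : Algebra k k']
  deg2 : Module.finrank k k' = 2
  x : K ⊗[k] k'
  y : K ⊗[k] k'
  z : K ⊗[k] k'
  nontriv : ¬(x = 0 ∧ y = 0 ∧ z = 0)
  eqn : algebraMap K (K ⊗[k] k') a * x ^ 2 + algebraMap K (K ⊗[k] k') b * y ^ 2 = z ^ 2

section QuaternionConic

variable {K : Type} [Field K] {a b : K}

/-- If the conic `a x² + b y² = z²` has no point, then the quaternion norm form is anisotropic. -/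
lemma eq_zero_of_quaternion_norm_eq_zero
    (hC : ∀ x y z : K, a * x ^ 2 + b * y ^ 2 = z ^ 2 → x = 0 ∧ y = 0 ∧ z = 0)
    {x₀ x₁ x₂ x₃ : K} (h : x₀ ^ 2 - a * x₁ ^ 2 - b * x₂ ^ 2 + a * b * x₃ ^ 2 = 0) :
    x₀ = 0 ∧ x₁ = 0 ∧ x₂ = 0 ∧ x₃ = 0 := by
  obtain ⟨-, hY, -⟩ := hC (x₀ * x₃ + x₁ * x₂) (x₂ ^ 2 - a * x₃ ^ 2) (x₀ * x₂ + a * x₁ * x₃)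
    (by linear_combination (-(x₂ ^ 2 - a * x₃ ^ 2)) * h)
  obtain ⟨h₃, -, h₂⟩ := hC x₃ 0 x₂ (by linear_combination -hY)
  subst h₃ h₂
  obtain ⟨h₁, -, h₀⟩ := hC x₁ 0 x₀ (by linear_combination -h)
  exact ⟨h₀, h₁, rfl, rfl⟩

/-- If the conic `a x² + b y² = z²` has no point, then `(a, b)` is a division algebra. -/
lemma quaternion_exists_left_inv
    (hC : ∀ x y z : K, a * x ^ 2 + b * y ^ 2 = z ^ 2 → x = 0 ∧ y = 0 ∧ z = 0)
    (q : ℍ[K,a,b]) (hq : q ≠ 0) : ∃ r, r * q = 1 := by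
  have hN : q.re ^ 2 - a * q.imI ^ 2 - b * q.imJ ^ 2 + a * b * q.imK ^ 2 ≠ 0 := fun h ↦ by
    obtain ⟨h₀, h₁, h₂, h₃⟩ := eq_zero_of_quaternion_norm_eq_zero hC h
    exact hq (QuaternionAlgebra.ext h₀ h₁ h₂ h₃)
  refine ⟨(q.re ^ 2 - a * q.imI ^ 2 - b * q.imJ ^ 2 + a * b * q.imK ^ 2)⁻¹ • star q, ?_⟩
  have hmul : star q * q =
      (q.re ^ 2 - a * q.imI ^ 2 - b * q.imJ ^ 2 + a * b * q.imK ^ 2) • (1 : ℍ[K,a,b]) := by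
    ext <;> simp <;> ring
  rw [smul_mul_assoc, hmul, smul_smul, inv_mul_cancel₀ hN, one_smul]

/-- Skolem–Noether for endomorphisms of quaternion algebras: every one is given by an
intertwining element. -/
lemma quaternion_exists_intertwiner (h2 : (2 : K) ≠ 0) (ha : a ≠ 0) (hb : b ≠ 0)
    (g : ℍ[K,a,b] →ₐ[K] ℍ[K,a,b]) : ∃ c : ℍ[K,a,b], c ≠ 0 ∧ ∀ x, g x * c = c * x := by
  set I : ℍ[K,a,b] := ⟨0, 1, 0, 0⟩ with hI
  set J : ℍ[K,a,b] := ⟨0, 0, 1, 0⟩ with hJ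
  have hII : I * I = a • (1 : ℍ[K,a,b]) := by ext <;> simp [hI]
  have hJJ : J * J = b • (1 : ℍ[K,a,b]) := by ext <;> simp [hJ]
  have hJI : J * I = -(I * J) := by ext <;> simp [hI, hJ]
  have hAA : g I * g I = a • (1 : ℍ[K,a,b]) := by rw [← map_mul, hII, map_smul, map_one]
  have hBB : g J * g J = b • (1 : ℍ[K,a,b]) := by rw [← map_mul, hJJ, map_smul, map_one]
  have hBA : g J * g I = -(g I * g J) := by rw [← map_mul, hJI, map_neg, map_mul]
  set A := g I
  set B := g J
  have hIIl (x : ℍ[K,a,b]) : I * (I * x) = a • x := by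
    rw [← mul_assoc, hII, smul_mul_assoc, one_mul]
  have hJIl (x : ℍ[K,a,b]) : J * (I * x) = -(I * (J * x)) := by
    rw [← mul_assoc, hJI, neg_mul, mul_assoc]
  have hAAl (x : ℍ[K,a,b]) : A * (A * x) = a • x := by
    rw [← mul_assoc, hAA, smul_mul_assoc, one_mul]
  have hBBl (x : ℍ[K,a,b]) : B * (B * x) = b • x := by
    rw [← mul_assoc, hBB, smul_mul_assoc, one_mul]
  have hBAl (x : ℍ[K,a,b]) : B * (A * x) = -(A * (B * x)) := by
    rw [← mul_assoc, hBA, neg_mul, mul_assoc]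
  let c (t : ℍ[K,a,b]) : ℍ[K,a,b] :=
    (a * b) • t + b • (A * (t * I)) + a • (B * (t * J)) - A * (B * (t * (I * J)))
  have hAc (t) : A * c t = c t * I := by
    simp only [c, mul_add, mul_sub, add_mul, sub_mul, mul_smul_comm, smul_mul_assoc, mul_assoc,
      hIIl, hAAl, hII, hJI, mul_neg, smul_neg, mul_one]
    module
  have hBc (t) : B * c t = c t * J := by
    simp only [c, mul_add, mul_sub, add_mul, sub_mul, mul_smul_comm, smul_mul_assoc, mul_assoc,
      hBBl, hBAl, hJJ, smul_neg, mul_one]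
    module
  obtain ⟨t, ht⟩ : ∃ t, c t ≠ 0 := by
    by_contra! h
    have key : (a * b) • c 1 + b • (c I * I) + a • (c J * J) - c (I * J) * (I * J) =
        (2 * 2 * (a * b) ^ 2) • (1 : ℍ[K,a,b]) := by
      simp only [c, add_mul, sub_mul, mul_smul_comm, smul_mul_assoc, mul_assoc, one_mul,
        hIIl, hJIl, hII, hJJ, hJI, mul_neg, neg_mul, smul_neg, mul_one]
      module
    simp only [h, smul_zero, zero_mul, add_zero, sub_zero] at key
    have := congrArg QuaternionAlgebra.re key
    simp [h2, ha, hb] at this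
  refine ⟨c t, ht, fun x ↦ ?_⟩
  have hx : x = x.re • 1 + x.imI • I + x.imJ • J + x.imK • (I * J) := by
    ext <;> simp [hI, hJ]
  rw [hx]
  simp only [map_add, map_smul, map_mul, map_one, add_mul, mul_add, smul_mul_assoc, mul_smul_comm,
    one_mul, mul_one]
  change _ + _ • (A * c t) + _ • (B * c t) + _ • (A * B * c t) = _
  rw [mul_assoc, hBc, ← mul_assoc, hAc, mul_assoc]

/-- Every endomorphism of a quaternion division algebra fixes a nonzero pure quaternion. -/
lemma quaternion_exists_pure_fixed (h2 : (2 : K) ≠ 0) (ha : a ≠ 0) (hb : b ≠ 0)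
    (hdiv : ∀ q : ℍ[K,a,b], q ≠ 0 → ∃ r, r * q = 1)
    (g : ℍ[K,a,b] →ₐ[K] ℍ[K,a,b]) : ∃ v : ℍ[K,a,b], v ≠ 0 ∧ v.re = 0 ∧ g v = v := by
  obtain ⟨c, hc, hgc⟩ := quaternion_exists_intertwiner h2 ha hb g
  have hcancel {x y : ℍ[K,a,b]} (h : x * c = y * c) : x = y := by
    by_contra hxy
    obtain ⟨r, hr⟩ := hdiv _ (sub_ne_zero.2 hxy)
    refine hc ?_
    rw [← one_mul c, ← hr, mul_assoc, sub_mul, h, sub_self, mul_zero]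
  by_cases him : c.im = 0
  · refine ⟨⟨0, 1, 0, 0⟩, fun h ↦ one_ne_zero (congrArg QuaternionAlgebra.imI h), rfl,
      hcancel ?_⟩
    rw [hgc, ← QuaternionAlgebra.re_add_im c, him, add_zero, QuaternionAlgebra.coe_commutes]
  · refine ⟨c.im, him, rfl, hcancel ?_⟩
    rw [hgc, ← QuaternionAlgebra.sub_re_self, mul_sub, sub_mul, QuaternionAlgebra.coe_commutes]

/-- The square of a pure quaternion is central. -/
lemma quaternion_mul_self_of_re_eq_zero {v : ℍ[K,a,b]} (hv : v.re = 0) :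
    v * v = ((a * v.imI ^ 2 + b * v.imJ ^ 2 - a * b * v.imK ^ 2 : K) : ℍ[K,a,b]) := by
  ext
  · simp only [QuaternionAlgebra.re_mul, QuaternionAlgebra.re_coe, hv]
    ring
  · simp only [QuaternionAlgebra.imI_mul, QuaternionAlgebra.imI_coe, hv]
    ring
  · simp only [QuaternionAlgebra.imJ_mul, QuaternionAlgebra.imJ_coe, hv]
    ring
  · simp only [QuaternionAlgebra.imK_mul, QuaternionAlgebra.imK_coe, hv]
    ring

/-- A ring endomorphism preserving the centre preserves pure quaternions. -/
lemma quaternion_re_map_eq_zero (h2 : (2 : K) ≠ 0)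
    (hdiv : ∀ q : ℍ[K,a,b], q ≠ 0 → ∃ r, r * q = 1)
    (φ : ℍ[K,a,b] →+* ℍ[K,a,b]) (σ : K ≃+* K) (hφ : ∀ x : K, φ (x : ℍ[K,a,b]) = (σ x : K))
    {v : ℍ[K,a,b]} (hv : v.re = 0) : (φ v).re = 0 := by
  by_contra hre
  have hsq := quaternion_mul_self_of_re_eq_zero hv
  have hsq' := congrArg φ hsq
  rw [map_mul, hφ] at hsq'
  have h1 := congrArg QuaternionAlgebra.imI hsq'
  have h2' := congrArg QuaternionAlgebra.imJ hsq'
  have h3 := congrArg QuaternionAlgebra.imK hsq'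
  simp only [QuaternionAlgebra.imI_mul, QuaternionAlgebra.imJ_mul, QuaternionAlgebra.imK_mul,
    QuaternionAlgebra.imI_coe, QuaternionAlgebra.imJ_coe, QuaternionAlgebra.imK_coe] at h1 h2' h3
  have hcoe : φ v = ((φ v).re : ℍ[K,a,b]) := by
    have h2re := mul_ne_zero h2 hre
    refine QuaternionAlgebra.ext rfl (mul_left_cancel₀ h2re ?_) (mul_left_cancel₀ h2re ?_)
      (mul_left_cancel₀ h2re ?_)
    · rw [QuaternionAlgebra.imI_coe]
      linear_combination h1
    · rw [QuaternionAlgebra.imJ_coe]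
      linear_combination h2'
    · rw [QuaternionAlgebra.imK_coe]
      linear_combination h3
  have hv' : v - ((σ.symm (φ v).re : K) : ℍ[K,a,b]) ≠ 0 := fun h ↦ hre <| by
    have := congrArg QuaternionAlgebra.re h
    simpa [hv] using this
  obtain ⟨r, hr⟩ := hdiv _ hv'
  have := congrArg φ hr
  rw [map_mul, map_sub, hφ, RingEquiv.apply_symm_apply, ← hcoe, sub_self, mul_zero, map_one] at this
  exact zero_ne_one this

/-- A semilinear endomorphism of a quaternion division algebra, for an involution `σ` of the
centre, fixes a nonzero pure quaternion. -/
lemma quaternion_exists_pure_fixed_of_semilinear (h2 : (2 : K) ≠ 0) (ha : a ≠ 0) (hb : b ≠ 0)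
    (hdiv : ∀ q : ℍ[K,a,b], q ≠ 0 → ∃ r, r * q = 1)
    (φ : ℍ[K,a,b] →+* ℍ[K,a,b]) (σ : K ≃+* K) (hφ : ∀ x : K, φ (x : ℍ[K,a,b]) = (σ x : K))
    (hσ : ∀ x, σ (σ x) = x) {δ : K} (hδ : δ ≠ 0) (hσδ : σ δ = -δ) :
    ∃ v : ℍ[K,a,b], v ≠ 0 ∧ v.re = 0 ∧ φ v = v := by
  let g : ℍ[K,a,b] →ₐ[K] ℍ[K,a,b] :=
    { φ.comp φ with
      commutes' := fun x ↦ by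
        change φ (φ (x : ℍ[K,a,b])) = (x : ℍ[K,a,b])
        rw [hφ, hφ, hσ] }
  obtain ⟨v, hv, hre, hgv⟩ := quaternion_exists_pure_fixed h2 ha hb hdiv g
  replace hgv : φ (φ v) = v := hgv
  by_cases h : v + φ v = 0
  · refine ⟨(δ : ℍ[K,a,b]) * v, ?_, ?_, ?_⟩
    · rw [QuaternionAlgebra.coe_mul_eq_smul]
      exact smul_ne_zero hδ hv
    · simp [hre]
    · rw [map_mul, hφ, hσδ, eq_neg_of_add_eq_zero_right h, QuaternionAlgebra.coe_neg, neg_mul_neg]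
  · refine ⟨v + φ v, h, ?_, ?_⟩
    · rw [QuaternionAlgebra.re_add, hre, quaternion_re_map_eq_zero h2 hdiv φ σ hφ hre, add_zero]
    · rw [map_add, hgv, add_comm]

end QuaternionConic

open Matrix in
/-- A ring automorphism of a matrix ring over a division ring induces an endomorphism of the
division ring with the same effect on the centre, up to inversion. -/
lemma exists_ringHom_of_matrix_ringEquiv {ι Q : Type} [Fintype ι] [DecidableEq ι] [Nonempty ι]
    [Ring Q] [Nontrivial Q] (hdiv : ∀ q : Q, q ≠ 0 → ∃ r, r * q = 1)
    (Ψ : Matrix ι ι Q ≃+* Matrix ι ι Q) :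
    ∃ φ : Q →+* Q, ∀ z w : Q, (∀ q, z * q = q * z) →
      Ψ (Matrix.scalar ι w) = Matrix.scalar ι z → φ z = w := by
  obtain ⟨i⟩ := ‹Nonempty ι›
  let e (q : Q) : Matrix ι ι Q := Ψ (Matrix.single i i q)
  have he_mul (p q : Q) : e (p * q) = e p * e q := by
    rw [← map_mul, Matrix.single_mul_single_same]
  have he_add (p q : Q) : e (p + q) = e p + e q := by
    simp only [e, ← map_add, Matrix.single_add]
  have he_one : e 1 ≠ 0 := by
    rw [Ne, map_eq_zero_iff _ Ψ.injective]
    exact fun h ↦ one_ne_zero (α := Q) (by simpa using congrFun₂ h i i)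
  obtain ⟨u, hu, heu⟩ : ∃ u : ι → Q, u ≠ 0 ∧ e 1 *ᵥ u = u := by
    obtain ⟨w, hw⟩ : ∃ w, e 1 *ᵥ w ≠ 0 := by
      by_contra! h
      exact he_one (Matrix.ext_of_mulVec_single fun j ↦ by rw [h, Matrix.zero_mulVec])
    exact ⟨_, hw, by rw [Matrix.mulVec_mulVec, ← he_mul, one_mul]⟩
  have hinj (q : Q) (h : e q *ᵥ u = 0) : q = 0 := by
    by_contra hq
    obtain ⟨r, hr⟩ := hdiv q hq
    refine hu ?_
    rw [← heu, ← hr, he_mul, ← Matrix.mulVec_mulVec, h, Matrix.mulVec_zero]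
  have hinj' {p q : Q} (h : e p *ᵥ u = e q *ᵥ u) : p = q := by
    rw [← sub_eq_zero]
    refine hinj _ ?_
    have : e p = e (p - q) + e q := by rw [← he_add, sub_add_cancel]
    rw [this, Matrix.add_mulVec] at h
    simpa using h
  have hex (q : Q) : ∃ q', e q' *ᵥ u = MulOpposite.op q • u := by
    obtain ⟨j, hj⟩ := Function.ne_iff.1 hu
    obtain ⟨r, hr⟩ := hdiv (u j) hj
    let M : Matrix ι ι Q := Matrix.vecMulVec (MulOpposite.op q • u) (Pi.single j r)
    have hM : M *ᵥ u = MulOpposite.op q • u := by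
      rw [Matrix.vecMulVec_mulVec, single_dotProduct, hr, MulOpposite.op_one, one_smul]
    refine ⟨Ψ.symm M i i, ?_⟩
    have h1 : e (Ψ.symm M i i) = e 1 * M * e 1 := by
      conv_rhs => rw [← Ψ.apply_symm_apply M]
      rw [← map_mul, ← map_mul, Matrix.single_mul_mul_single, one_mul, mul_one]
    rw [h1, ← Matrix.mulVec_mulVec, heu, ← Matrix.mulVec_mulVec, hM, Matrix.mulVec_smul, heu]
  choose φ hφ using hex
  refine ⟨⟨⟨⟨φ, ?_⟩, ?_⟩, ?_, ?_⟩, ?_⟩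
  · exact hinj' (by rw [hφ, heu, MulOpposite.op_one, one_smul])
  · intro p q
    refine hinj' ?_
    change e (φ (p * q)) *ᵥ u = e (φ p * φ q) *ᵥ u
    rw [hφ, he_mul, ← Matrix.mulVec_mulVec, hφ, Matrix.mulVec_smul, hφ, smul_smul,
      MulOpposite.op_mul]
  · refine hinj' ?_
    have : e 0 = 0 := by rw [← add_right_cancel_iff (a := e 0), ← he_add]; simp
    change e (φ 0) *ᵥ u = _
    rw [hφ, this]; simp
  · intro p q
    refine hinj' ?_
    change e (φ (p + q)) *ᵥ u = e (φ p + φ q) *ᵥ u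
    rw [hφ, he_add, Matrix.add_mulVec, hφ, hφ, MulOpposite.op_add, add_smul]
  · intro z w hz hzw
    refine hinj' ?_
    change e (φ z) *ᵥ u = _
    have h1 : e w = Matrix.scalar ι z * e 1 := by
      rw [← hzw, ← map_mul]
      refine congrArg Ψ ?_
      rw [Matrix.scalar_apply, ← Matrix.smul_eq_diagonal_mul]
      simp
    rw [hφ, h1, ← Matrix.mulVec_mulVec, heu]
    ext j
    simp [Matrix.mulVec_diagonal, hz]

/-- The nontrivial automorphism of a quadratic extension in characteristic zero. -/
lemma exists_quadratic_conj (k K : Type) [Field k] [Field K] [Algebra k K] [CharZero k]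
    (hdeg : Module.finrank k K = 2) :
    ∃ σ : K ≃ₐ[k] K, (∀ x, σ (σ x) = x) ∧ (∃ δ : K, δ ≠ 0 ∧ σ δ = -δ) ∧
      ∀ x, σ x = x → x ∈ Set.range (algebraMap k K) := by
  have : FiniteDimensional k K := Module.finite_of_finrank_eq_succ hdeg
  have : Algebra.IsQuadraticExtension k K := { finrank_eq_two' := hdeg }
  have hcard : Nat.card (K ≃ₐ[k] K) = 2 := by rw [IsGalois.card_aut_eq_finrank, hdeg]
  obtain ⟨σ, hσ, huniq⟩ := (Nat.card_eq_two_iff' (1 : K ≃ₐ[k] K)).1 hcard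
  have hσσ : σ * σ = 1 := by
    by_contra h
    exact hσ (by simpa using huniq _ h)
  have hinv (x : K) : σ (σ x) = x := DFunLike.congr_fun hσσ x
  refine ⟨σ, hinv, ?_, fun x hx ↦ ?_⟩
  · obtain ⟨x, hx⟩ : ∃ x, σ x ≠ x := by
      by_contra! h
      exact hσ (AlgEquiv.ext h)
    exact ⟨x - σ x, sub_ne_zero.2 hx.symm, by rw [map_sub, hinv, neg_sub]⟩
  · rw [IsGalois.mem_range_algebraMap_iff_fixed]
    intro f
    by_cases hf : f = 1
    · rw [hf]; rfl
    · rw [huniq f hf, hx]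

/-- Let `k` be a field of characteristic zero, `K/k` a (separable) field extension
of degree 2, `C : a x² + b y² = z²` a smooth conic over `K` whose class `[C] ∈ Br(K)` lies in
the image of `Br(k) → Br(K)`, and `X = R_{K/k} C` the Weil restriction, with `X(k) = ∅`
(equivalently, `C(K) = ∅`).  Then the index of `X` is 2: `X` acquires a rational point over
some quadratic extension `k'` of `k` (and it has no `k`-point, by hypothesis; by Springer's
theorem there is then no odd-degree point either, so `I(X) = 2`). -/
theorem stmt7 (k K : Type) [Field k] [Field K] [Algebra k K] [CharZero k]
    (hdeg : Module.finrank k K = 2)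
    (a b : K) (ha : a ≠ 0) (hb : b ≠ 0)
    (hnopoint : ¬ ∃ x y z : K, ¬(x = 0 ∧ y = 0 ∧ z = 0) ∧ a * x ^ 2 + b * y ^ 2 = z ^ 2)
    (hBr : Nonempty (CentralSimpleLift k K a b)) :
    Nonempty (QuadraticPointWitness k K a b) := by
  have hC (x y z : K) (h : a * x ^ 2 + b * y ^ 2 = z ^ 2) : x = 0 ∧ y = 0 ∧ z = 0 := by
    by_contra hne
    exact hnopoint ⟨x, y, z, hne, h⟩
  have : CharZero K := charZero_of_injective_algebraMap (algebraMap k K).injective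
  have hdiv := quaternion_exists_left_inv hC
  obtain ⟨σ, hσ, ⟨δ, hδ, hσδ⟩, hfix⟩ := exists_quadratic_conj k K hdeg
  obtain ⟨⟨D, -, -, -, n, m, -, hm, ⟨E⟩⟩⟩ := hBr
  have : NeZero m := ⟨hm.ne'⟩
  let Ψ : Matrix (Fin m) (Fin m) ℍ[K,a,b] ≃+* Matrix (Fin m) (Fin m) ℍ[K,a,b] :=
    (E.symm.toRingEquiv.trans
      (Algebra.TensorProduct.congr σ (AlgEquiv.refl : D ≃ₐ[k] D)).toRingEquiv.mapMatrix).trans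
      E.toRingEquiv
  have hΨ (x : K) : Ψ (algebraMap K _ x) = algebraMap K _ (σ x) := by
    change E (((Algebra.TensorProduct.congr σ (AlgEquiv.refl : D ≃ₐ[k] D)).toRingEquiv.mapMatrix)
      (E.symm (algebraMap K _ x))) = _
    rw [AlgEquiv.commutes, ← E.commutes]
    congr 1
    ext i j
    by_cases hij : i = j <;>
      simp [hij, Matrix.algebraMap_matrix_apply, Algebra.TensorProduct.algebraMap_apply]
  obtain ⟨φ, hφ⟩ := exists_ringHom_of_matrix_ringEquiv hdiv Ψ
  have hφσ (x : K) : φ (x : ℍ[K,a,b]) = (σ x : K) := by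
    refine hφ _ _ (fun q ↦ QuaternionAlgebra.coe_commutes x q) ?_
    have := hΨ (σ x)
    rw [hσ] at this
    exact this
  obtain ⟨v, hv, hre, hφv⟩ := quaternion_exists_pure_fixed_of_semilinear two_ne_zero ha hb hdiv φ
    σ.toRingEquiv hφσ hσ hδ hσδ
  have hsq := quaternion_mul_self_of_re_eq_zero hre
  obtain ⟨r, hr⟩ := hfix (a * v.imI ^ 2 + b * v.imJ ^ 2 - a * b * v.imK ^ 2) <| by
    have := congrArg φ hsq
    rw [map_mul, hφv, hφσ, hsq] at this
    exact (QuaternionAlgebra.coe_injective this).symm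
  have hirr : Irreducible (Polynomial.X ^ 2 - Polynomial.C r : Polynomial k) := by
    rw [X_pow_sub_C_irreducible_iff_of_prime Nat.prime_two]
    intro s hs
    obtain ⟨-, h₁, h₂, h₃⟩ := eq_zero_of_quaternion_norm_eq_zero hC
      (x₀ := algebraMap k K s) (x₁ := v.imI) (x₂ := v.imJ) (x₃ := v.imK) (by
        rw [← map_pow, hs, hr]; ring)
    exact hv (QuaternionAlgebra.ext hre h₁ h₂ h₃)
  have := Fact.mk hirr
  let k' := AdjoinRoot (Polynomial.X ^ 2 - Polynomial.C r : Polynomial k)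
  have hdeg' : Module.finrank k k' = 2 :=
    finrank_quotient_span_eq_natDegree.trans (Polynomial.natDegree_X_pow_sub_C)
  let ι : K →+* K ⊗[k] k' := algebraMap K (K ⊗[k] k')
  have hι : Function.Injective ι := ι.injective
  let s : K ⊗[k] k' := 1 ⊗ₜ[k] AdjoinRoot.root _
  have hs : s ^ 2 = ι a * ι v.imI ^ 2 + ι b * ι v.imJ ^ 2 - ι a * ι b * ι v.imK ^ 2 := by
    have hroot : (AdjoinRoot.root _ : k') ^ 2 = algebraMap k k' r := by
      have := AdjoinRoot.eval₂_root (Polynomial.X ^ 2 - Polynomial.C r : Polynomial k)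
      rw [Polynomial.eval₂_sub, Polynomial.eval₂_X_pow, Polynomial.eval₂_C, sub_eq_zero] at this
      exact this
    simp only [← map_mul, ← map_pow, ← map_add, ← map_sub]
    rw [← hr, Algebra.TensorProduct.tmul_pow, hroot, one_pow]
    exact Algebra.TensorProduct.algebraMap_apply' (R := k) (A := K) (B := k') r |>.symm
  by_cases hY : v.imJ ^ 2 - a * v.imK ^ 2 = 0
  · obtain ⟨h₃, -, h₂⟩ := hC v.imK 0 v.imJ (by linear_combination -hY)
    refine ⟨⟨k', hdeg', ι v.imI, 0, s, fun h ↦ hv ?_, ?_⟩⟩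
    · exact QuaternionAlgebra.ext hre ((map_eq_zero_iff ι hι).1 h.1) h₂ h₃
    · rw [hs, h₂, h₃, map_zero]
      ring
  · refine ⟨⟨k', hdeg', s * ι v.imK + ι v.imI * ι v.imJ, ι (v.imJ ^ 2 - a * v.imK ^ 2),
      s * ι v.imJ + ι a * ι v.imI * ι v.imK, fun h ↦ hY ((map_eq_zero_iff ι hι).1 h.2.1), ?_⟩⟩
    simp only [map_sub, map_mul, map_pow]
    change ι a * _ + ι b * _ = _
    linear_combination (-(ι v.imJ ^ 2 - ι a * ι v.imK ^ 2)) * hs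
end

section
/- Let k be a field of characteristic zero, C₁ and C₂ smooth conics over k with quaternion algebra classes [C₁], [C₂] ∈ Br(k), and X = C₁ × C₂. Then the index I(X) equals 4 if and only if the biquaternion algebra corresponding to [C₁] + [C₂] is a division algebra; otherwise I(X) divides 2. -/
open scoped Quaternion TensorProduct

/-- The smooth conic `a x² + b y² = z²` (associated to the quaternion algebra `(a,b)` over `k`)
has a point over the extension `L` of `k`. -/
def ConicHasPoint (k : Type) [Field k] (a b : k) (L : Type) [Field L] [Algebra k L] : Prop :=
  ∃ x y z : L, ¬(x = 0 ∧ y = 0 ∧ z = 0) ∧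
    algebraMap k L a * x ^ 2 + algebraMap k L b * y ^ 2 = z ^ 2

theorem exists_isotropic_of_norm_isotropic {L : Type} [Field L] {a b s u v w : L}
    (h : ¬(s = 0 ∧ u = 0 ∧ v = 0 ∧ w = 0))
    (e : a * u ^ 2 + b * v ^ 2 - a * b * w ^ 2 = s ^ 2) :
    ∃ x y z : L, ¬(x = 0 ∧ y = 0 ∧ z = 0) ∧ a * x ^ 2 + b * y ^ 2 = z ^ 2 := by
  by_cases hn : v ^ 2 - a * w ^ 2 = 0
  · by_cases hw : w = 0
    · subst hw
      have hv : v = 0 := by simpa using hn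
      subst hv
      refine ⟨u, 0, s, ?_, by linear_combination e⟩
      rintro ⟨rfl, -, rfl⟩
      simp at h
    · exact ⟨w, 0, v, fun h' => hw h'.1, by linear_combination -hn⟩
  · exact ⟨s * w + u * v, v ^ 2 - a * w ^ 2, s * v + a * u * w, fun h' => hn h'.2.1, by
      linear_combination (v ^ 2 - a * w ^ 2) * e⟩

theorem exists_matrices_of_isotropic {L : Type} [Field L] {a b x y z : L}
    (h : ¬(x = 0 ∧ y = 0 ∧ z = 0)) (e : a * x ^ 2 + b * y ^ 2 = z ^ 2) :
    ∃ I J : Matrix (Fin 2) (Fin 2) L, I * I = a • 1 ∧ J * J = b • 1 ∧ J * I = -(I * J) := by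
  by_cases hy : y = 0
  · subst hy
    have hx : x ≠ 0 := by
      rintro rfl
      simp at e h
      exact h (by simpa using e.symm)
    have ha : a = (z / x) ^ 2 := by
      field_simp
      linear_combination e
    refine ⟨!![z / x, 0; 0, -(z / x)], !![0, b; 1, 0], ?_, ?_, ?_⟩ <;> ext i j <;>
      fin_cases i <;> fin_cases j <;> simp [Matrix.mul_apply, Fin.sum_univ_two, ha] <;> ring
  · have hb : b = (z / y) ^ 2 - a * (x / y) ^ 2 := by
      field_simp
      linear_combination e
    refine ⟨!![0, a; 1, 0], !![z / y, -(a * (x / y)); x / y, -(z / y)], ?_, ?_, ?_⟩ <;> ext i j <;>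
      fin_cases i <;> fin_cases j <;> simp [Matrix.mul_apply, Fin.sum_univ_two, hb] <;> ring

open scoped Kronecker in
/-- If both conics have an `L`-point, the biquaternion algebra acts on `L⁴`. -/
theorem exists_algHom_matrix {k : Type} [Field k] {a b c d : k} {L : Type} [Field L] [Algebra k L]
    (h₁ : ConicHasPoint k a b L) (h₂ : ConicHasPoint k c d L) :
    Nonempty (ℍ[k,a,b] ⊗[k] ℍ[k,c,d] →ₐ[k] Matrix (Fin 2 × Fin 2) (Fin 2 × Fin 2) L) := by
  obtain ⟨x, y, z, h, e⟩ := h₁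
  obtain ⟨I, J, hI, hJ, hJI⟩ := exists_matrices_of_isotropic h e
  obtain ⟨x', y', z', h', e'⟩ := h₂
  obtain ⟨I', J', hI', hJ', hJI'⟩ := exists_matrices_of_isotropic h' e'
  let f : ℍ[k,a,b] →ₐ[k] Matrix (Fin 2) (Fin 2) L := QuaternionAlgebra.lift
    { i := I, j := J, k := I * J, i_mul_i := by simp [hI], j_mul_j := by simp [hJ],
      i_mul_j := rfl, j_mul_i := by simp [hJI] }
  let g : ℍ[k,c,d] →ₐ[k] Matrix (Fin 2) (Fin 2) L := QuaternionAlgebra.lift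
    { i := I', j := J', k := I' * J', i_mul_i := by simp [hI'], j_mul_j := by simp [hJ'],
      i_mul_j := rfl, j_mul_i := by simp [hJI'] }
  let l : Matrix (Fin 2) (Fin 2) L →ₐ[k] Matrix (Fin 2 × Fin 2) (Fin 2 × Fin 2) L :=
    AlgHom.ofLinearMap
      { toFun M := M ⊗ₖ (1 : Matrix (Fin 2) (Fin 2) L)
        map_add' M N := Matrix.add_kronecker M N _
        map_smul' r M := Matrix.smul_kronecker r M _ }
      Matrix.one_kronecker_one
      (fun M N => by simp [← Matrix.mul_kronecker_mul])
  let r : Matrix (Fin 2) (Fin 2) L →ₐ[k] Matrix (Fin 2 × Fin 2) (Fin 2 × Fin 2) L :=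
    AlgHom.ofLinearMap
      { toFun M := (1 : Matrix (Fin 2) (Fin 2) L) ⊗ₖ M
        map_add' M N := Matrix.kronecker_add _ M N
        map_smul' r M := Matrix.kronecker_smul r _ M }
      Matrix.one_kronecker_one
      (fun M N => by simp [← Matrix.mul_kronecker_mul])
  exact ⟨Algebra.TensorProduct.lift (l.comp f) (r.comp g) fun p q => by
    change (f p ⊗ₖ (1 : Matrix (Fin 2) (Fin 2) L)) * ((1 : Matrix (Fin 2) (Fin 2) L) ⊗ₖ g q) =
      ((1 : Matrix (Fin 2) (Fin 2) L) ⊗ₖ g q) * (f p ⊗ₖ (1 : Matrix (Fin 2) (Fin 2) L))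
    simp [← Matrix.mul_kronecker_mul]⟩

theorem finrank_dvd_of_algHom_matrix {k D L n : Type} [Field k] [Ring D] [Algebra k D]
    [Nontrivial D] [Field L] [Algebra k L] [FiniteDimensional k L] [Fintype n] [DecidableEq n]
    (hD : ∀ x : D, x ≠ 0 → IsUnit x) (φ : D →ₐ[k] Matrix n n L) :
    Module.finrank k D ∣ Fintype.card n * Module.finrank k L := by
  let : DivisionRing D := DivisionRing.ofIsUnitOrEqZero fun x => by
    by_cases hx : x = 0
    · exact Or.inr hx
    · exact Or.inl (hD x hx)
  let ψ : D →+* Module.End L (n → L) := (Matrix.toLinAlgEquiv' (R := L)).toRingHom.comp φ.toRingHom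
  let : Module D (n → L) := Module.compHom (n → L) ψ
  have hψ (x : D) (v : n → L) : x • v = Matrix.mulVec (φ x) v := rfl
  have : IsScalarTower k D (n → L) := ⟨fun r x v => by
    rw [hψ, hψ, map_smul, Matrix.smul_mulVec]⟩
  have h := Module.finrank_mul_finrank k D (n → L)
  rw [Module.finrank_pi_fintype] at h
  simp only [Finset.sum_const, Finset.card_univ, smul_eq_mul] at h
  exact ⟨_, h.symm⟩

/-- Some extension of degree dividing `2` carries points of both conics. -/
def HaveCommonQuadraticPoints (k : Type) [Field k] (a b c d : k) : Prop :=
  ∃ L : IntermediateField k (AlgebraicClosure k), FiniteDimensional k ↥L ∧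
    ConicHasPoint k a b ↥L ∧ ConicHasPoint k c d ↥L ∧ Module.finrank k ↥L ∣ 2

section

variable {k : Type} [Field k] {a b c d : k}

theorem HaveCommonQuadraticPoints.of_sqrt (e : k)
    (h : ∀ (L : Type) [Field L] [Algebra k L] (s : L), s ^ 2 = algebraMap k L e →
      ConicHasPoint k a b L ∧ ConicHasPoint k c d L) : HaveCommonQuadraticPoints k a b c d := by
  obtain ⟨s, hs⟩ := IsAlgClosed.exists_pow_nat_eq (algebraMap k (AlgebraicClosure k) e) two_pos
  have hroot : Polynomial.aeval s (Polynomial.X ^ 2 - Polynomial.C e) = 0 := by simp [hs]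
  have hmonic : (Polynomial.X ^ 2 - Polynomial.C e).Monic :=
    Polynomial.monic_X_pow_sub_C e two_ne_zero
  have hint : IsIntegral k s := ⟨_, hmonic, by simpa [Polynomial.aeval_def] using hroot⟩
  have := h (IntermediateField.adjoin k {s}) (IntermediateField.AdjoinSimple.gen k s)
    (Subtype.ext (by simpa using hs))
  refine ⟨_, IntermediateField.adjoin.finiteDimensional hint, this.1, this.2, ?_⟩
  rw [IntermediateField.adjoin.finrank hint]
  have hle := Polynomial.natDegree_le_of_dvd (minpoly.dvd k s hroot) hmonic.ne_zero
  have hpos := minpoly.natDegree_pos hint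
  rw [Polynomial.natDegree_X_pow_sub_C] at hle
  interval_cases (minpoly k s).natDegree <;> norm_num

theorem ConicHasPoint.base {L : Type} [Field L] [Algebra k L] (h : ConicHasPoint k a b k) :
    ConicHasPoint k a b L := by
  obtain ⟨x, y, z, h, e⟩ := h
  refine ⟨algebraMap k L x, algebraMap k L y, algebraMap k L z, by simpa using h, ?_⟩
  simp only [Algebra.algebraMap_self, RingHom.id_apply] at e
  simp only [← map_pow, ← map_mul, ← map_add, e]

theorem ConicHasPoint.of_sqrt {L : Type} [Field L] [Algebra k L] {s : L}
    (hs : s ^ 2 = algebraMap k L a) : ConicHasPoint k a b L :=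
  ⟨1, 0, s, by simp, by simp [hs]⟩

theorem HaveCommonQuadraticPoints.of_left (h : ConicHasPoint k a b k) :
    HaveCommonQuadraticPoints k a b c d :=
  .of_sqrt c fun _ _ _ _ hs => ⟨h.base, .of_sqrt hs⟩

theorem HaveCommonQuadraticPoints.of_right (h : ConicHasPoint k c d k) :
    HaveCommonQuadraticPoints k a b c d :=
  .of_sqrt a fun _ _ _ _ hs => ⟨.of_sqrt hs, h.base⟩

namespace QuaternionAlgebra

/-- The reduced norm. -/
def reducedNorm (p : ℍ[k,a,b]) : k :=
  p.re ^ 2 - a * p.imI ^ 2 - b * p.imJ ^ 2 + a * b * p.imK ^ 2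

/-- The polar form of the reduced norm. -/
def reducedPolar (p q : ℍ[k,a,b]) : k :=
  2 * (p.re * q.re - a * (p.imI * q.imI) - b * (p.imJ * q.imJ) + a * b * (p.imK * q.imK))

theorem star_mul_self_eq_reducedNorm (p : ℍ[k,a,b]) :
    star p * p = algebraMap k _ p.reducedNorm := by
  ext <;> simp [reducedNorm, algebraMap_eq] <;> ring

theorem star_mul_add_star_mul (p q : ℍ[k,a,b]) :
    star p * q + star q * p = algebraMap k _ (reducedPolar p q) := by
  ext <;> simp [reducedPolar, algebraMap_eq] <;> ring

theorem conicHasPoint_of_reducedNorm_eq_zero {p : ℍ[k,a,b]} (hp : p ≠ 0)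
    (h : p.reducedNorm = 0) : ConicHasPoint k a b k := by
  refine exists_isotropic_of_norm_isotropic (s := p.re) (u := p.imI) (v := p.imJ) (w := p.imK)
    (fun h0 => hp (QuaternionAlgebra.ext h0.1 h0.2.1 h0.2.2.1 h0.2.2.2)) ?_
  simp only [reducedNorm] at h
  simp only [Algebra.algebraMap_self, RingHom.id_apply]
  linear_combination -h

/-- The norm of `p + q √c` from `(a,b)` over `k(√c)` down to `k` does not vanish. -/
theorem norm_sq_sub_ne_zero [CharZero k] (hc : c ≠ 0)
    (hG : ¬HaveCommonQuadraticPoints k a b c d) {p q : ℍ[k,a,b]} (hpq : ¬(p = 0 ∧ q = 0)) :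
    (p.reducedNorm + c * q.reducedNorm) ^ 2 - c * reducedPolar p q ^ 2 ≠ 0 := by
  intro h0
  by_cases ht : reducedPolar p q = 0
  swap
  · refine hG (.of_right ⟨reducedPolar p q, 0, p.reducedNorm + c * q.reducedNorm,
      fun h => ht h.1, ?_⟩)
    simp only [Algebra.algebraMap_self, RingHom.id_apply]
    linear_combination -h0
  have hn : p.reducedNorm + c * q.reducedNorm = 0 := by simpa [ht] using h0
  by_cases hq : q.reducedNorm = 0
  · have hp : p.reducedNorm = 0 := by simpa [hq] using hn
    by_cases hp0 : p = 0
    · exact hG (.of_left (conicHasPoint_of_reducedNorm_eq_zero (fun hq0 => hpq ⟨hp0, hq0⟩) hq))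
    · exact hG (.of_left (conicHasPoint_of_reducedNorm_eq_zero hp0 hp))
  · refine hG (.of_sqrt c fun L _ _ s hs => ⟨?_, .of_sqrt hs⟩)
    have hs0 : s ≠ 0 := by
      rintro rfl
      exact hc (by simpa using hs.symm)
    refine exists_isotropic_of_norm_isotropic (s := s * algebraMap k L q.reducedNorm)
      (u := algebraMap k L (p * star q).imI) (v := algebraMap k L (p * star q).imJ)
      (w := algebraMap k L (p * star q).imK)
      (fun h => mul_ne_zero hs0 (by simpa using hq) h.1) ?_
    rw [mul_pow, hs]
    simp only [← map_pow, ← map_mul, ← map_add, ← map_sub]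
    congr 1
    simp [reducedNorm, reducedPolar] at hn ht ⊢
    linear_combination (-(q.re ^ 2 - a * q.imI ^ 2 - b * q.imJ ^ 2 + a * b * q.imK ^ 2)) * hn +
      (p.re * q.re - a * (p.imI * q.imI) - b * (p.imJ * q.imJ) + a * b * (p.imK * q.imK)) * ht

/-- Commuting elements `p`, `q` with `p² - c q² = d` generate a common quadratic subfield. -/
theorem haveCommonQuadraticPoints_of_commute [CharZero k] {p q : ℍ[k,a,b]} (hcomm : p * q = q * p)
    (ha : a ≠ 0) (hb : b ≠ 0) (h : p * p - c • (q * q) = algebraMap k _ d) :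
    HaveCommonQuadraticPoints k a b c d := by
  obtain ⟨x, y, z, m, n, hxyz, hp, hq⟩ : ∃ x y z m n : k, ¬(x = 0 ∧ y = 0 ∧ z = 0) ∧
      p = ⟨p.re, m * x, m * y, m * z⟩ ∧ q = ⟨q.re, n * x, n * y, n * z⟩ := by
    by_cases hp : p.imI = 0 ∧ p.imJ = 0 ∧ p.imK = 0
    · by_cases hq : q.imI = 0 ∧ q.imJ = 0 ∧ q.imK = 0
      · exact ⟨1, 0, 0, 0, 0, by simp, by ext <;> simp [hp], by ext <;> simp [hq]⟩
      · exact ⟨q.imI, q.imJ, q.imK, 0, 1, hq, by ext <;> simp [hp], by ext <;> simp⟩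
    · have hI := congrArg QuaternionAlgebra.imI hcomm
      have hJ := congrArg QuaternionAlgebra.imJ hcomm
      have hK := congrArg QuaternionAlgebra.imK hcomm
      simp at hI hJ hK
      have hI' : p.imJ * q.imK = p.imK * q.imJ :=
        mul_left_cancel₀ (mul_ne_zero two_ne_zero hb) (by linear_combination -hI)
      have hJ' : p.imI * q.imK = p.imK * q.imI :=
        mul_left_cancel₀ (mul_ne_zero two_ne_zero ha) (by linear_combination hJ)
      have hK' : p.imI * q.imJ = p.imJ * q.imI :=
        mul_left_cancel₀ two_ne_zero (by linear_combination hK)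
      obtain ⟨n, h1, h2, h3⟩ : ∃ n, q.imI = n * p.imI ∧ q.imJ = n * p.imJ ∧ q.imK = n * p.imK := by
        by_cases h1 : p.imI = 0
        · by_cases h2 : p.imJ = 0
          · have h3 : p.imK ≠ 0 := fun h3 => hp ⟨h1, h2, h3⟩
            refine ⟨q.imK / p.imK, ?_, ?_, ?_⟩ <;> field_simp <;> grind
          · refine ⟨q.imJ / p.imJ, ?_, ?_, ?_⟩ <;> field_simp <;> grind
        · refine ⟨q.imI / p.imI, ?_, ?_, ?_⟩ <;> field_simp <;> grind
      exact ⟨p.imI, p.imJ, p.imK, 1, n, hp, by ext <;> simp, by ext <;> simp [h1, h2, h3]⟩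
  generalize p.re = r at hp
  generalize q.re = t at hq
  subst hp hq
  have hre := congrArg QuaternionAlgebra.re h
  have hI := congrArg QuaternionAlgebra.imI h
  have hJ := congrArg QuaternionAlgebra.imJ h
  have hK := congrArg QuaternionAlgebra.imK h
  simp [algebraMap_eq] at hre hI hJ hK
  have hrt : r * m - c * (t * n) = 0 := by
    by_contra h0
    refine hxyz ⟨?_, ?_, ?_⟩ <;> refine mul_left_cancel₀ (mul_ne_zero two_ne_zero h0) ?_
    · linear_combination hI
    · linear_combination hJ
    · linear_combination hK
  refine .of_sqrt (a * x ^ 2 + b * y ^ 2 - a * b * z ^ 2) fun L _ _ s hs => ⟨?_, ?_⟩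
  · refine exists_isotropic_of_norm_isotropic (s := s) (u := algebraMap k L x)
      (v := algebraMap k L y) (w := algebraMap k L z) (fun h0 => hxyz (by simpa using h0.2)) ?_
    rw [hs]
    simp
  · refine ⟨algebraMap k L t + algebraMap k L n * s, 1, algebraMap k L r + algebraMap k L m * s,
      by simp, ?_⟩
    have h1 := congrArg (algebraMap k L) hrt
    have h2 := congrArg (algebraMap k L) hre
    simp only [map_add, map_sub, map_mul, map_pow, map_zero] at h1 h2 hs
    linear_combination (-2 * s) * h1 - h2 +
      (algebraMap k L c * algebraMap k L n ^ 2 - algebraMap k L m ^ 2) * hs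

end QuaternionAlgebra

open QuaternionAlgebra

theorem isUnit_of_not_haveCommonQuadraticPoints [CharZero k] (ha : a ≠ 0) (hb : b ≠ 0)
    (hc : c ≠ 0) (hG : ¬HaveCommonQuadraticPoints k a b c d) {D : Type} [Ring D] [Algebra k D]
    [FiniteDimensional k D] (ι : ℍ[k,a,b] →ₐ[k] D) {e f : D} (he : e * e = algebraMap k D c)
    (hf : f * f = algebraMap k D d) (hfe : f * e = -(e * f)) (hιe : ∀ p, e * ι p = ι p * e)
    (hιf : ∀ p, f * ι p = ι p * f) {p q p' q' : ℍ[k,a,b]}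
    (h0 : ¬((p = 0 ∧ q = 0) ∧ p' = 0 ∧ q' = 0)) :
    IsUnit (ι p + ι q * e + (ι p' + ι q' * e) * f) := by
  have : IsNoetherianRing D := IsNoetherianRing.of_finite k D
  have mul (p q r s : ℍ[k,a,b]) : (ι p + ι q * e) * (ι r + ι s * e) =
      ι (p * r + c • (q * s)) + ι (p * s + q * r) * e := by
    have h : ι q * e * (ι s * e) = c • (ι q * ι s) := by
      rw [mul_assoc, ← mul_assoc e, hιe, mul_assoc, he, ← mul_assoc, ← Algebra.commutes,
        Algebra.smul_def]
    rw [mul_add, add_mul, add_mul, h, mul_assoc (ι q), hιe]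
    simp only [map_add, map_mul, map_smul, add_mul, mul_assoc]
    abel
  have left_inv {p q : ℍ[k,a,b]} (hpq : ¬(p = 0 ∧ q = 0)) :
      ∃ r s : ℍ[k,a,b], (ι r + ι s * e) * (ι p + ι q * e) = 1 := by
    have hN := norm_sq_sub_ne_zero hc hG hpq
    set n := p.reducedNorm + c * q.reducedNorm
    set t := reducedPolar p q
    have h1 : (ι (star p) + ι (star q) * e) * (ι p + ι q * e) =
        ι (algebraMap k _ n) + ι (algebraMap k _ t) * e := by
      rw [mul, star_mul_self_eq_reducedNorm, star_mul_self_eq_reducedNorm, star_mul_add_star_mul]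
      simp [n, t, Algebra.smul_def]
    obtain ⟨r, s, hrs⟩ : ∃ r s : ℍ[k,a,b],
        ι r + ι s * e = (ι (algebraMap k _ (n * (n ^ 2 - c * t ^ 2)⁻¹)) +
          ι (algebraMap k _ (-(t * (n ^ 2 - c * t ^ 2)⁻¹))) * e) *
            (ι (star p) + ι (star q) * e) := ⟨_, _, (mul _ _ _ _).symm⟩
    refine ⟨r, s, ?_⟩
    rw [hrs, mul_assoc, h1, mul]
    have e1 : n * (n ^ 2 - c * t ^ 2)⁻¹ * n + c * (-(t * (n ^ 2 - c * t ^ 2)⁻¹) * t) = 1 := by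
      field_simp
      ring
    have e2 : n * (n ^ 2 - c * t ^ 2)⁻¹ * t + -(t * (n ^ 2 - c * t ^ 2)⁻¹) * n = 0 := by ring
    rw [← map_mul, ← map_mul, ← map_mul, ← map_mul, Algebra.smul_def, ← map_mul, ← map_add,
      ← map_add, e1, e2]
    simp
  have isUnit {p q : ℍ[k,a,b]} (hpq : ¬(p = 0 ∧ q = 0)) : IsUnit (ι p + ι q * e) := by
    obtain ⟨r, s, h⟩ := left_inv hpq
    exact IsUnit.of_mul_eq_one_right _ h
  by_cases h' : p' = 0 ∧ q' = 0
  · simpa [h'.1, h'.2] using isUnit fun h => h0 ⟨h, h'⟩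
  obtain ⟨r, s, hrs⟩ := left_inv h'
  obtain ⟨x, y, hxy⟩ : ∃ x y : ℍ[k,a,b], ι x + ι y * e =
    (ι r + ι s * e) * (ι p + ι q * e) := ⟨_, _, (mul _ _ _ _).symm⟩
  have hxyf : (ι r + ι s * e) * (ι p + ι q * e + (ι p' + ι q' * e) * f) = ι x + ι y * e + f := by
    rw [mul_add, ← mul_assoc, hrs, hxy, one_mul]
  have hfc : f * (ι x + ι y * e) = (ι x + ι (-y) * e) * f := by
    rw [mul_add, add_mul, hιf, ← mul_assoc, hιf, mul_assoc, hfe, map_neg, neg_mul, neg_mul,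
      mul_neg, mul_assoc]
  have hnorm : (ι x + ι (-y) * e - f) * (ι x + ι y * e + f) =
      ι (x * x - c • (y * y) - algebraMap k _ d) + ι (x * y - y * x) * e := by
    have h1 : ι (x * x - c • (y * y) - algebraMap k _ d) + ι (x * y - y * x) * e =
        (ι x + ι (-y) * e) * (ι x + ι y * e) - algebraMap k D d := by
      rw [mul]
      simp only [map_sub, map_add, map_mul, map_neg, map_smul, AlgHom.commutes, neg_mul, smul_neg,
        sub_mul, add_mul]
      abel
    rw [h1, sub_mul, mul_add, mul_add f, hfc, hf]
    abel
  have hne : ¬(x * x - c • (y * y) - algebraMap k _ d = 0 ∧ x * y - y * x = 0) := fun h =>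
    hG (haveCommonQuadraticPoints_of_commute (sub_eq_zero.1 h.2) ha hb (sub_eq_zero.1 h.1))
  obtain ⟨u, v, huv⟩ := left_inv hne
  rw [← hnorm, ← hxyf, ← mul_assoc, ← mul_assoc] at huv
  exact IsUnit.of_mul_eq_one_right _ huv

theorem exists_eq_biquaternion (w : ℍ[k,a,b] ⊗[k] ℍ[k,c,d]) : ∃ p q p' q' : ℍ[k,a,b],
    w = p ⊗ₜ 1 + q ⊗ₜ 1 * 1 ⊗ₜ ⟨0, 1, 0, 0⟩ +
      (p' ⊗ₜ 1 + q' ⊗ₜ 1 * 1 ⊗ₜ ⟨0, 1, 0, 0⟩) * 1 ⊗ₜ ⟨0, 0, 1, 0⟩ := by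
  induction w with
  | zero => exact ⟨0, 0, 0, 0, by simp⟩
  | add x y hx hy =>
    obtain ⟨p, q, p', q', rfl⟩ := hx
    obtain ⟨r, s, r', s', rfl⟩ := hy
    refine ⟨p + r, q + s, p' + r', q' + s', ?_⟩
    simp only [TensorProduct.add_tmul, add_mul]
    abel
  | tmul x y =>
    refine ⟨y.re • x, y.imI • x, y.imJ • x, y.imK • x, ?_⟩
    simp only [Algebra.TensorProduct.tmul_mul_tmul, add_mul, mul_one,
      TensorProduct.smul_tmul, ← TensorProduct.tmul_add]
    congr 1
    ext <;> simp

theorem isUnit_biquaternion [CharZero k] (ha : a ≠ 0) (hb : b ≠ 0) (hc : c ≠ 0)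
    (hG : ¬HaveCommonQuadraticPoints k a b c d) {w : ℍ[k,a,b] ⊗[k] ℍ[k,c,d]} (hw : w ≠ 0) :
    IsUnit w := by
  obtain ⟨p, q, p', q', rfl⟩ := exists_eq_biquaternion w
  refine isUnit_of_not_haveCommonQuadraticPoints ha hb hc hG
    (Algebra.TensorProduct.includeLeft : ℍ[k,a,b] →ₐ[k] ℍ[k,a,b] ⊗[k] ℍ[k,c,d])
    ?_ ?_ ?_ (by simp) (by simp) ?_
  · rw [Algebra.TensorProduct.tmul_mul_tmul, Algebra.TensorProduct.algebraMap_apply',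
      one_mul]
    congr 1
    ext <;> simp [algebraMap_eq]
  · rw [Algebra.TensorProduct.tmul_mul_tmul, Algebra.TensorProduct.algebraMap_apply',
      one_mul]
    congr 1
    ext <;> simp [algebraMap_eq]
  · rw [Algebra.TensorProduct.tmul_mul_tmul, Algebra.TensorProduct.tmul_mul_tmul,
      ← TensorProduct.tmul_neg]
    congr 1
    ext <;> simp
  · rintro ⟨⟨rfl, rfl⟩, rfl, rfl⟩
    simp at hw

theorem four_dvd_finrank (hD : ∀ x : ℍ[k,a,b] ⊗[k] ℍ[k,c,d], x ≠ 0 → IsUnit x) {L : Type}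
    [Field L] [Algebra k L] [FiniteDimensional k L] (h₁ : ConicHasPoint k a b L) (h₂ : ConicHasPoint k c d L) :
    4 ∣ Module.finrank k L := by
  obtain ⟨φ⟩ := exists_algHom_matrix h₁ h₂
  have hfin : Module.finrank k (ℍ[k,a,b] ⊗[k] ℍ[k,c,d]) = 16 := by
    simp [Module.finrank_tensorProduct, QuaternionAlgebra.finrank_eq_four]
  have : Nontrivial (ℍ[k,a,b] ⊗[k] ℍ[k,c,d]) :=
    Module.nontrivial_of_finrank_pos (R := k) (by rw [hfin]; norm_num)
  have h := finrank_dvd_of_algHom_matrix hD φ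
  rw [hfin] at h
  simp only [Fintype.card_prod, Fintype.card_fin] at h
  lia

end

/-- Let `C₁`, `C₂` be smooth conics over a field `k` of characteristic zero, with
quaternion classes `(a,b)` and `(c,d)`, and `X = C₁ × C₂`.  The index `I(X)` is the gcd of the
degrees of closed points of `X`, equivalently of the degrees `[L:k]` of the finite extensions
`L/k` (inside a fixed algebraic closure) such that both conics acquire an `L`-point; it always
divides 4.  Then `I(X) = 4` (i.e. every such degree is divisible by 4) if and only if the
biquaternion algebra `(a,b) ⊗ (c,d)` representing `[C₁] + [C₂]` is a division algebra; and
otherwise `I(X)` divides 2, i.e. some extension of degree dividing 2 carries points of both. -/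
theorem stmt12 (k : Type) [Field k] [CharZero k]
    (a b c d : k) (ha : a ≠ 0) (hb : b ≠ 0) (hc : c ≠ 0) (hd : d ≠ 0) :
    ((∀ L : IntermediateField k (AlgebraicClosure k), FiniteDimensional k ↥L →
        ConicHasPoint k a b ↥L → ConicHasPoint k c d ↥L → 4 ∣ Module.finrank k ↥L)
      ↔ (∀ x : ℍ[k,a,b] ⊗[k] ℍ[k,c,d], x ≠ 0 → IsUnit x)) ∧
    (¬ (∀ x : ℍ[k,a,b] ⊗[k] ℍ[k,c,d], x ≠ 0 → IsUnit x) →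
      ∃ L : IntermediateField k (AlgebraicClosure k), FiniteDimensional k ↥L ∧
        ConicHasPoint k a b ↥L ∧ ConicHasPoint k c d ↥L ∧ Module.finrank k ↥L ∣ 2) := by
  have key : ¬(∀ x : ℍ[k,a,b] ⊗[k] ℍ[k,c,d], x ≠ 0 → IsUnit x) →
      HaveCommonQuadraticPoints k a b c d := fun h => by
    by_contra hG
    exact h fun x hx => isUnit_biquaternion ha hb hc hG hx
  refine ⟨⟨fun h => ?_, fun hD L _ h₁ h₂ => four_dvd_finrank hD h₁ h₂⟩, key⟩
  by_contra hD
  obtain ⟨L, hL, h₁, h₂, h2⟩ := key hD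
  have := Nat.le_of_dvd two_pos ((h L hL h₁ h₂).trans h2)
  omega
end
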